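/- (Optimal C^{1,1} regularity for the double obstacle problem on the flat torus.) Let φ₋, φ₊ : ℝ^d → ℝ be non-constant C², (2πℤ)^d-periodic functions with φ₊ − φ₋ ≥ τ everywhere for some τ > 0, and assume max φ₋ ≥ min φ₊. Then the unique continuous periodic solution u of the double obstacle problem is of class C^{1,1}: u is continuously differentiable and its gradient ∇u is Lipschitz continuous on ℝ^d. -/

import Mathlib

open MeasureTheory Real

noncomputable section

/-- Euclidean space `ℝ^d`. -/
abbrev Rd (d : ℕ) := EuclideanSpace ℝ (Fin d)

/-- `f : ℝ^d → α` is `(2πℤ)^d`-periodic. -/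
def PeriodicRd {d : ℕ} {α : Type*} (f : Rd d → α) : Prop :=
  ∀ (x : Rd d) (j : Fin d),
    f (x + (2 * Real.pi) • EuclideanSpace.single j (1 : ℝ)) = f x

/-- The Euclidean Laplacian `Δ = ∑ ∂²/∂xⱼ²`. -/
noncomputable def lapRd {d : ℕ} (f : Rd d → ℝ) (x : Rd d) : ℝ :=
  ∑ j : Fin d,
    fderiv ℝ (fun y => fderiv ℝ f y (EuclideanSpace.single j (1 : ℝ))) x
      (EuclideanSpace.single j (1 : ℝ))

/-- The fundamental domain `E = [0,2π)^d`. -/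
def EfdR (d : ℕ) : Set (Rd d) := {x | ∀ j : Fin d, x j ∈ Set.Ico 0 (2 * Real.pi)}

/-- `u` is a solution of the double obstacle problem with obstacles `φ₋ ≤ u ≤ φ₊`:
`u` is continuous, periodic, trapped between the obstacles, distributionally
subharmonic on `{u > φ₋}` and distributionally superharmonic on `{u < φ₊}`. -/
def IsDOPSolution {d : ℕ} (φm φp u : Rd d → ℝ) : Prop :=
  Continuous u ∧ PeriodicRd u ∧ (∀ x, φm x ≤ u x ∧ u x ≤ φp x) ∧
    (∀ χ : Rd d → ℝ, ContDiff ℝ (⊤ : ℕ∞) χ → HasCompactSupport χ → (∀ x, 0 ≤ χ x) →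
      tsupport χ ⊆ {x | φm x < u x} → 0 ≤ ∫ x : Rd d, u x * lapRd χ x) ∧
    (∀ χ : Rd d → ℝ, ContDiff ℝ (⊤ : ℕ∞) χ → HasCompactSupport χ → (∀ x, 0 ≤ χ x) →
      tsupport χ ⊆ {x | u x < φp x} → (∫ x : Rd d, u x * lapRd χ x) ≤ 0)

/-! ### Quadratic Taylor remainders -/

section Taylor

variable {E : Type*} [NormedAddCommGroup E] [NormedSpace ℝ E]

/-- The first order Taylor remainder is quadratic if the derivative is Lipschitz. -/
lemma taylor_of_lipschitzWith_fderiv {g : E → ℝ} (hg : Differentiable ℝ g) {M : NNReal}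
    (hM : LipschitzWith M (fderiv ℝ g)) (x y : E) :
    |g y - g x - fderiv ℝ g x (y - x)| ≤ M * ‖y - x‖ ^ 2 := by
  have := (convex_closedBall x ‖y - x‖).norm_image_sub_le_of_norm_fderiv_le'
    (f := g) (φ := fderiv ℝ g x) (C := M * ‖y - x‖) (x := x) (y := y)
    (fun w _ => hg w) (fun w hw => (hM.norm_sub_le w x).trans ?_)
    (Metric.mem_closedBall_self (norm_nonneg _)) (by simp [dist_eq_norm])
  · rw [← Real.norm_eq_abs]; refine this.trans (le_of_eq (by ring))
  · have : ‖w - x‖ ≤ ‖y - x‖ := by simpa [dist_eq_norm] using hw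
    gcongr

lemma exists_taylor_of_hasCompactSupport {g : E → ℝ} (hg : ContDiff ℝ 2 g)
    (hc : HasCompactSupport g) : ∃ M : ℝ, 0 ≤ M ∧ ∀ x y : E,
      |g y - g x - fderiv ℝ g x (y - x)| ≤ M * ‖y - x‖ ^ 2 := by
  have h1 : ContDiff ℝ 1 (fderiv ℝ g) := hg.fderiv_right (by norm_num)
  obtain ⟨M, hM⟩ := h1.lipschitzWith_of_hasCompactSupport (hc.fderiv ℝ) (by norm_num)
  exact ⟨M, M.2, taylor_of_lipschitzWith_fderiv (hg.differentiable (by norm_num)) hM⟩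

end Taylor

/-! ### A radial kernel and its potential -/

/-- A smooth nonnegative radial kernel supported in the unit ball. -/
def radialKernel {d : ℕ} (y : Rd d) : ℝ := deriv expNegInvGlue (1 - ‖y‖ ^ 2)

/-- The radial potential of `radialKernel`: its gradient at `y` is `-radialKernel y • y`. -/
def radialPotential {d : ℕ} (y : Rd d) : ℝ := expNegInvGlue (1 - ‖y‖ ^ 2) / 2

lemma hasDerivAt_expNegInvGlue (x : ℝ) :
    HasDerivAt expNegInvGlue ((x⁻¹) ^ 2 * expNegInvGlue x) x := by
  simpa using expNegInvGlue.hasDerivAt_polynomial_eval_inv_mul 1 x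

lemma deriv_expNegInvGlue (x : ℝ) :
    deriv expNegInvGlue x = (x⁻¹) ^ 2 * expNegInvGlue x :=
  (hasDerivAt_expNegInvGlue x).deriv

section Kernel

variable {d : ℕ}

lemma radialKernel_contDiff : ContDiff ℝ 2 (radialKernel (d := d)) := by
  have h : ContDiff ℝ 2 (deriv expNegInvGlue) := by
    have : ContDiff ℝ (2 + 1) expNegInvGlue := by
      exact_mod_cast expNegInvGlue.contDiff (n := 3)
    exact (contDiff_succ_iff_deriv.1 this).2.2
  exact h.comp (contDiff_const.sub (contDiff_norm_sq ℝ))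

lemma radialPotential_contDiff : ContDiff ℝ 2 (radialPotential (d := d)) := by
  have h : ContDiff ℝ 2 expNegInvGlue := by
    exact_mod_cast expNegInvGlue.contDiff (n := 2)
  exact (h.comp (contDiff_const.sub (contDiff_norm_sq ℝ))).div_const 2

lemma radialKernel_nonneg (y : Rd d) : 0 ≤ radialKernel y := by
  rw [radialKernel, deriv_expNegInvGlue]
  exact mul_nonneg (sq_nonneg _) (expNegInvGlue.nonneg _)

lemma radialPotential_nonneg (y : Rd d) : 0 ≤ radialPotential y :=
  div_nonneg (expNegInvGlue.nonneg _) zero_le_two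

lemma radialKernel_neg (y : Rd d) : radialKernel (-y) = radialKernel y := by
  simp [radialKernel]

lemma radialKernel_eq_zero {y : Rd d} (hy : 1 ≤ ‖y‖) : radialKernel y = 0 := by
  rw [radialKernel, deriv_expNegInvGlue, expNegInvGlue.zero_of_nonpos (by nlinarith), mul_zero]

lemma radialPotential_eq_zero {y : Rd d} (hy : 1 ≤ ‖y‖) : radialPotential y = 0 := by
  rw [radialPotential, expNegInvGlue.zero_of_nonpos (by nlinarith), zero_div]

lemma radialKernel_hasCompactSupport : HasCompactSupport (radialKernel (d := d)) :=
  HasCompactSupport.intro (isCompact_closedBall 0 1) fun y hy =>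
    radialKernel_eq_zero (by simpa using (not_le.1 (by simpa using hy)).le)

lemma radialPotential_hasCompactSupport : HasCompactSupport (radialPotential (d := d)) :=
  HasCompactSupport.intro (isCompact_closedBall 0 1) fun y hy =>
    radialPotential_eq_zero (by simpa using (not_le.1 (by simpa using hy)).le)

lemma exists_le_radialKernel :
    ∃ c : ℝ, 0 < c ∧ ∀ y : Rd d, ‖y‖ ≤ 2 / 3 → c ≤ radialKernel y := by
  refine ⟨expNegInvGlue (1 / 2), expNegInvGlue.pos_of_pos (by norm_num), fun y hy => ?_⟩
  have h0 := norm_nonneg y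
  have h1 : 1 / 2 ≤ 1 - ‖y‖ ^ 2 := by nlinarith
  have h2 : 1 - ‖y‖ ^ 2 ≤ 1 := by nlinarith
  rw [radialKernel, deriv_expNegInvGlue]
  have h3 : 1 ≤ (1 - ‖y‖ ^ 2)⁻¹ := (one_le_inv₀ (by linarith)).2 h2
  calc expNegInvGlue (1 / 2) ≤ expNegInvGlue (1 - ‖y‖ ^ 2) := expNegInvGlue.monotone h1
    _ ≤ _ := le_mul_of_one_le_left (expNegInvGlue.nonneg _) (by nlinarith)

lemma exists_radialKernel_le : ∃ K : ℝ, 0 < K ∧ ∀ y : Rd d, radialKernel y ≤ K := by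
  obtain ⟨K, hK⟩ := radialKernel_hasCompactSupport.exists_bound_of_continuous
    (radialKernel_contDiff (d := d)).continuous
  exact ⟨max K 1, by positivity, fun y =>
    ((le_abs_self _).trans (hK y)).trans (le_max_left _ _)⟩

lemma integral_radialKernel_pos : 0 < ∫ y : Rd d, radialKernel y := by
  obtain ⟨c, hc, h⟩ := exists_le_radialKernel (d := d)
  refine (radialKernel_contDiff (d := d)).continuous.integral_pos_of_hasCompactSupport_nonneg_nonzero
    radialKernel_hasCompactSupport radialKernel_nonneg (x := 0) ?_
  exact (hc.trans_le (h 0 (by norm_num))).ne'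

lemma fderiv_radialPotential (y e : Rd d) :
    fderiv ℝ radialPotential y e = -(inner ℝ y e * radialKernel y) := by
  have h1 : HasFDerivAt (fun y : Rd d => 1 - ‖y‖ ^ 2) (-(2 • innerSL ℝ y)) y := by
    simpa using ((hasStrictFDerivAt_norm_sq y).hasFDerivAt).const_sub 1
  have h2 := ((hasDerivAt_expNegInvGlue (1 - ‖y‖ ^ 2)).comp_hasFDerivAt y h1).mul_const (1 / 2 : ℝ)
  have h3 : radialPotential (d := d) = fun z => (expNegInvGlue ∘ fun y => 1 - ‖y‖ ^ 2) z * (1 / 2) := by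
    ext z
    simp [radialPotential, div_eq_mul_inv]
  rw [h3, h2.fderiv, radialKernel, deriv_expNegInvGlue]
  simp
  ring

end Kernel

/-! ### The mean value inequality for `C²` functions -/

section MeanValue

variable {d : ℕ}

lemma integrable_mul_of_hasCompactSupport {f k : Rd d → ℝ} (hf : Continuous f)
    (hk : Continuous k) (hc : HasCompactSupport k) : Integrable fun y => f y * k y :=
  (hf.mul hk).integrable_of_hasCompactSupport hc.mul_left

lemma integrable_mul_radialKernel {f : Rd d → ℝ} (hf : Continuous f) :
    Integrable fun y => f y * radialKernel y :=
  integrable_mul_of_hasCompactSupport hf radialKernel_contDiff.continuous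
    radialKernel_hasCompactSupport

lemma fderiv_apply_eq_sum (L : Rd d →L[ℝ] ℝ) (y : Rd d) :
    L y = ∑ j, y j * L (EuclideanSpace.single j (1 : ℝ)) := by
  conv_lhs => rw [← (EuclideanSpace.basisFun (Fin d) ℝ).sum_repr y]
  simp

lemma continuous_lapRd {v : Rd d → ℝ} (hv : ContDiff ℝ 2 v) : Continuous (lapRd v) := by
  have h1 : ContDiff ℝ 1 (fderiv ℝ v) := hv.fderiv_right (by norm_num)
  refine continuous_finsetSum _ fun j _ => ?_
  have h2 : ContDiff ℝ 1 fun y => fderiv ℝ v y (EuclideanSpace.single j (1 : ℝ)) :=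
    h1.clm_apply contDiff_const
  exact (h2.continuous_fderiv (by norm_num)).clm_apply continuous_const

/-- Integration by parts turns the radial derivative against the kernel into the Laplacian
against the potential. -/
lemma integral_fderiv_mul_radialKernel {v : Rd d → ℝ} (hv : ContDiff ℝ 2 v) (x : Rd d) (t : ℝ) :
    ∫ y, fderiv ℝ v (x + t • y) y * radialKernel y =
      t * ∫ y, lapRd v (x + t • y) * radialPotential y := by
  have h1 : ContDiff ℝ 1 (fderiv ℝ v) := hv.fderiv_right (by norm_num)
  have hP := radialPotential_contDiff (d := d)
  have hPc := radialPotential_hasCompactSupport (d := d)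
  have haff : ContDiff ℝ 1 fun y : Rd d => x + t • y := by fun_prop
  have h2 : ∀ j : Fin d, ContDiff ℝ 1 fun y => fderiv ℝ v y (EuclideanSpace.single j (1 : ℝ)) :=
    fun j => h1.clm_apply contDiff_const
  have h3 : ∀ j : Fin d, ContDiff ℝ 1
      fun y => fderiv ℝ v (x + t • y) (EuclideanSpace.single j (1 : ℝ)) :=
    fun j => (h2 j).comp haff
  have h4 : ∀ (j : Fin d) (y : Rd d),
      fderiv ℝ (fun y => fderiv ℝ v (x + t • y) (EuclideanSpace.single j (1 : ℝ))) y
        (EuclideanSpace.single j (1 : ℝ)) =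
      t * fderiv ℝ (fun y => fderiv ℝ v y (EuclideanSpace.single j (1 : ℝ))) (x + t • y)
        (EuclideanSpace.single j (1 : ℝ)) := by
    intro j y
    have ha : HasFDerivAt (fun y : Rd d => x + t • y) (t • ContinuousLinearMap.id ℝ (Rd d)) y :=
      ((hasFDerivAt_id y).const_smul t).const_add x
    have hb := ((h2 j).differentiable (by norm_num) (x + t • y)).hasFDerivAt.comp y ha
    rw [show (fun y => fderiv ℝ v (x + t • y) (EuclideanSpace.single j (1 : ℝ))) =
      (fun y => fderiv ℝ v y (EuclideanSpace.single j (1 : ℝ))) ∘ fun y => x + t • y from rfl,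
      hb.fderiv]
    simp
  have hfd : ∀ j : Fin d, Continuous fun y =>
      fderiv ℝ (fun y => fderiv ℝ v (x + t • y) (EuclideanSpace.single j (1 : ℝ))) y
        (EuclideanSpace.single j (1 : ℝ)) :=
    fun j => ((h3 j).continuous_fderiv (by norm_num)).clm_apply continuous_const
  have hint1 : ∀ j : Fin d, Integrable fun y =>
      fderiv ℝ (fun y => fderiv ℝ v (x + t • y) (EuclideanSpace.single j (1 : ℝ))) y
        (EuclideanSpace.single j (1 : ℝ)) * radialPotential y :=
    fun j => integrable_mul_of_hasCompactSupport (hfd j) hP.continuous hPc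
  have hint2 : ∀ j : Fin d, Integrable fun y =>
      fderiv ℝ v (x + t • y) (EuclideanSpace.single j (1 : ℝ)) *
        fderiv ℝ radialPotential y (EuclideanSpace.single j (1 : ℝ)) := fun j =>
    integrable_mul_of_hasCompactSupport (h3 j).continuous
      ((hP.continuous_fderiv (by norm_num)).clm_apply continuous_const)
      (hPc.fderiv_apply ℝ _)
  have hibp : ∀ j : Fin d,
      ∫ y, fderiv ℝ v (x + t • y) (EuclideanSpace.single j (1 : ℝ)) *
        fderiv ℝ radialPotential y (EuclideanSpace.single j (1 : ℝ)) =
      - ∫ y, fderiv ℝ (fun y => fderiv ℝ v (x + t • y) (EuclideanSpace.single j (1 : ℝ))) y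
        (EuclideanSpace.single j (1 : ℝ)) * radialPotential y := fun j =>
    integral_mul_fderiv_eq_neg_fderiv_mul_of_integrable (hint1 j) (hint2 j)
      (integrable_mul_of_hasCompactSupport (h3 j).continuous hP.continuous hPc)
      (fun y _ => (h3 j).differentiable (by norm_num) y)
      (fun y _ => hP.differentiable (by norm_num) y)
  calc ∫ y, fderiv ℝ v (x + t • y) y * radialKernel y
      = ∫ y, ∑ j, -(fderiv ℝ v (x + t • y) (EuclideanSpace.single j (1 : ℝ)) *
        fderiv ℝ radialPotential y (EuclideanSpace.single j (1 : ℝ))) := by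
        congr 1
        ext y
        rw [fderiv_apply_eq_sum, Finset.sum_mul]
        refine Finset.sum_congr rfl fun j _ => ?_
        rw [fderiv_radialPotential, EuclideanSpace.inner_single_right]
        simp
        ring
    _ = ∑ j, ∫ y, fderiv ℝ (fun y => fderiv ℝ v (x + t • y)
        (EuclideanSpace.single j (1 : ℝ))) y (EuclideanSpace.single j (1 : ℝ)) *
          radialPotential y := by
        rw [integral_finsetSum _ fun j _ => by exact (hint2 j).neg]
        refine Finset.sum_congr rfl fun j _ => ?_
        rw [integral_neg, hibp, neg_neg]
    _ = _ := by
        rw [← integral_finsetSum _ fun j _ => hint1 j, ← integral_const_mul]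
        congr 1
        ext y
        rw [lapRd, Finset.sum_mul, Finset.mul_sum]
        refine Finset.sum_congr rfl fun j _ => ?_
        rw [h4]
        ring

lemma hasDerivAt_integral_mul_radialKernel {v : Rd d → ℝ} (hv : ContDiff ℝ 1 v) (x : Rd d)
    (t : ℝ) : HasDerivAt (fun s : ℝ => ∫ y, v (x + s • y) * radialKernel y)
      (∫ y, fderiv ℝ v (x + t • y) y * radialKernel y) t := by
  have hk := (radialKernel_contDiff (d := d)).continuous
  have hc1 : Continuous (fderiv ℝ v) := hv.continuous_fderiv (by norm_num)
  have hc2 : Continuous fun p : ℝ × Rd d => fderiv ℝ v (x + p.1 • p.2) p.2 :=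
    (hc1.comp (by fun_prop)).clm_apply continuous_snd
  obtain ⟨B, hB⟩ := ((isCompact_closedBall t 1).prod
    (isCompact_closedBall (0 : Rd d) 1)).exists_bound_of_continuousOn hc2.continuousOn
  have hcont : ∀ s : ℝ, Continuous fun y : Rd d => fderiv ℝ v (x + s • y) y := fun s =>
    hc2.comp (by fun_prop : Continuous fun y : Rd d => (s, y))
  refine (hasDerivAt_integral_of_dominated_loc_of_deriv_le
    (F := fun (s : ℝ) (y : Rd d) => v (x + s • y) * radialKernel y)
    (F' := fun (s : ℝ) (y : Rd d) => fderiv ℝ v (x + s • y) y * radialKernel y)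
    (bound := fun y => B * radialKernel y)
    (Metric.closedBall_mem_nhds t one_pos) ?_ ?_ ?_ ?_ ?_ ?_).2
  · exact Filter.Eventually.of_forall fun s =>
      ((hv.continuous.comp (by fun_prop)).mul hk).aestronglyMeasurable
  · exact integrable_mul_radialKernel (hv.continuous.comp (by fun_prop))
  · exact ((hcont t).mul hk).aestronglyMeasurable
  · refine Filter.Eventually.of_forall fun y s hs => ?_
    rw [norm_mul, Real.norm_of_nonneg (radialKernel_nonneg y)]
    rcases le_total 1 ‖y‖ with hy | hy
    · simp [radialKernel_eq_zero hy]
    · exact mul_le_mul_of_nonneg_right (hB (s, y) ⟨hs, by simpa using hy⟩)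
        (radialKernel_nonneg y)
  · exact integrable_mul_radialKernel continuous_const
  · refine Filter.Eventually.of_forall fun y s _ => ?_
    have ha : HasDerivAt (fun s : ℝ => x + s • y) y s := by
      simpa using ((hasDerivAt_id s).smul_const y).const_add x
    exact ((hv.differentiable (by norm_num) _).hasFDerivAt.comp_hasDerivAt s ha).mul_const _

/-- Mean value inequality: a lower bound on the Laplacian on a ball bounds the kernel average
from below. -/
lemma mul_integral_radialKernel_sub_le {v : Rd d → ℝ} (hv : ContDiff ℝ 2 v) {C r : ℝ}
    (hr : 0 ≤ r) (x : Rd d) (h : ∀ y ∈ Metric.closedBall x r, -C ≤ lapRd v y) :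
    v x * (∫ y : Rd d, radialKernel y) - C * (∫ y : Rd d, radialPotential y) * r ^ 2 / 2 ≤
      ∫ y, v (x + r • y) * radialKernel y := by
  set P := ∫ y : Rd d, radialPotential y with hP
  have hv1 : ContDiff ℝ 1 v := hv.of_le (by norm_num)
  have hPi : ∀ {f : Rd d → ℝ}, Continuous f → Integrable fun y => f y * radialPotential y :=
    fun hf => integrable_mul_of_hasCompactSupport hf radialPotential_contDiff.continuous
      radialPotential_hasCompactSupport
  have hder : ∀ t : ℝ, HasDerivAt
      (fun s : ℝ => (∫ y, v (x + s • y) * radialKernel y) + C * P * s ^ 2 / 2)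
      (t * (∫ y, lapRd v (x + t • y) * radialPotential y) + C * P * t) t := fun t => by
    have h1 := hasDerivAt_integral_mul_radialKernel hv1 x t
    rw [integral_fderiv_mul_radialKernel hv] at h1
    have h2 : HasDerivAt (fun s : ℝ => C * P * s ^ 2 / 2) (C * P * t) t := by
      refine (((hasDerivAt_pow 2 t).const_mul (C * P)).div_const 2).congr_deriv ?_
      push_cast
      ring
    exact h1.add h2
  have hmono : MonotoneOn
      (fun s : ℝ => (∫ y, v (x + s • y) * radialKernel y) + C * P * s ^ 2 / 2) (Set.Icc 0 r) := by
    refine monotoneOn_of_deriv_nonneg (convex_Icc 0 r)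
      (fun t _ => (hder t).continuousAt.continuousWithinAt)
      (fun t _ => (hder t).differentiableAt.differentiableWithinAt) fun t ht => ?_
    rw [interior_Icc] at ht
    rw [(hder t).deriv]
    have hle : -C * P ≤ ∫ y, lapRd v (x + t • y) * radialPotential y := by
      rw [hP, ← integral_const_mul]
      refine integral_mono (hPi continuous_const)
        (hPi ((continuous_lapRd hv).comp (by fun_prop))) fun y => ?_
      rcases le_total 1 ‖y‖ with hy | hy
      · simp [radialPotential_eq_zero hy]
      · refine mul_le_mul_of_nonneg_right (h _ ?_) (radialPotential_nonneg y)
        rw [Metric.mem_closedBall, dist_self_add_left, norm_smul, Real.norm_of_nonneg ht.1.le]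
        nlinarith [ht.1, ht.2, norm_nonneg y]
    nlinarith [ht.1]
  have := hmono (Set.left_mem_Icc.2 hr) (Set.right_mem_Icc.2 hr) hr
  simp only [zero_smul, add_zero, integral_const_mul] at this
  linarith

end MeanValue

/-! ### Mollification -/

section Mollification

variable {d : ℕ}

lemma fderiv_comp_const_sub_apply {g : Rd d → ℝ} (hg : Differentiable ℝ g) (x y e : Rd d) :
    fderiv ℝ (fun z => g (x - z)) y e = -fderiv ℝ g (x - y) e := by
  have h := (hg (x - y)).hasFDerivAt.comp y ((hasFDerivAt_id y).const_sub x)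
  rw [show (fun z => g (x - z)) = g ∘ HSub.hSub x from rfl, h.fderiv]
  simp

lemma lapRd_comp_const_sub {g : Rd d → ℝ} (hg : ContDiff ℝ 2 g) (x y : Rd d) :
    lapRd (fun z => g (x - z)) y = lapRd g (x - y) := by
  have h1 : ContDiff ℝ 1 (fderiv ℝ g) := hg.fderiv_right (by norm_num)
  refine Finset.sum_congr rfl fun j _ => ?_
  have h2 : ContDiff ℝ 1 fun y => -fderiv ℝ g y (EuclideanSpace.single j (1 : ℝ)) :=
    (h1.clm_apply contDiff_const).neg
  simp_rw [fderiv_comp_const_sub_apply (hg.differentiable (by norm_num))]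
  rw [fderiv_comp_const_sub_apply (h2.differentiable (by norm_num)), fderiv_fun_neg]
  simp

open ContinuousLinearMap in
lemma fderiv_convolution_apply {u ρ : Rd d → ℝ} (hu : Continuous u) (hρ : ContDiff ℝ 1 ρ)
    (hc : HasCompactSupport ρ) (x e : Rd d) :
    fderiv ℝ (convolution u ρ (lsmul ℝ ℝ).flip volume) x e =
      convolution u (fun y => fderiv ℝ ρ y e) (lsmul ℝ ℝ).flip volume x := by
  rw [(hc.hasFDerivAt_convolution_right _ hu.locallyIntegrable hρ x).fderiv,
    convolution_precompR_apply _ hu.locallyIntegrable (hc.fderiv ℝ)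
      (hρ.continuous_fderiv (by norm_num))]

open ContinuousLinearMap in
lemma lapRd_convolution {u ρ : Rd d → ℝ} (hu : Continuous u) (hρ : ContDiff ℝ 2 ρ)
    (hc : HasCompactSupport ρ) (x : Rd d) :
    lapRd (convolution u ρ (lsmul ℝ ℝ).flip volume) x =
      ∫ y, u y * lapRd (fun z => ρ (x - z)) y := by
  have h1 : ContDiff ℝ 1 (fderiv ℝ ρ) := hρ.fderiv_right (by norm_num)
  have h2 : ∀ j : Fin d, ContDiff ℝ 1 fun y => fderiv ℝ ρ y (EuclideanSpace.single j (1 : ℝ)) :=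
    fun j => h1.clm_apply contDiff_const
  have hc2 : ∀ j : Fin d,
      HasCompactSupport fun y => fderiv ℝ ρ y (EuclideanSpace.single j (1 : ℝ)) :=
    fun j => hc.fderiv_apply ℝ _
  simp_rw [lapRd_comp_const_sub hρ]
  unfold lapRd
  simp_rw [Finset.mul_sum]
  rw [integral_finsetSum]
  · refine Finset.sum_congr rfl fun j _ => ?_
    rw [show (fun y => fderiv ℝ (convolution u ρ (lsmul ℝ ℝ).flip volume) y
      (EuclideanSpace.single j (1 : ℝ))) = convolution u
        (fun y => fderiv ℝ ρ y (EuclideanSpace.single j (1 : ℝ))) (lsmul ℝ ℝ).flip volume from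
        funext fun y => fderiv_convolution_apply hu (hρ.of_le (by norm_num)) hc y _,
      fderiv_convolution_apply hu (h2 j) (hc2 j), convolution_def]
    simp [mul_comm]
  · intro j _
    refine integrable_mul_of_hasCompactSupport hu
      ((((h2 j).continuous_fderiv (by norm_num)).clm_apply continuous_const).comp
        (by fun_prop : Continuous fun y => x - y)) ?_
    exact ((hc2 j).fderiv_apply ℝ (EuclideanSpace.single j (1 : ℝ))).comp_homeomorph
      (Homeomorph.subLeft x)

open ContinuousLinearMap in
/-- Mollification at scale `ε`, with its Laplacian expressed through test functions. -/
lemma exists_mollification {u : Rd d → ℝ} (hu : Continuous u) {ε : ℝ} (hε : 0 < ε) :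
    ∃ v : Rd d → ℝ, ContDiff ℝ 2 v ∧
      (∀ x δ, (∀ y ∈ Metric.closedBall x ε, |u y - u x| ≤ δ) → |v x - u x| ≤ δ) ∧
      ∀ x, ∃ χ : Rd d → ℝ, ContDiff ℝ (⊤ : ℕ∞) χ ∧ HasCompactSupport χ ∧ (∀ y, 0 ≤ χ y) ∧
        tsupport χ ⊆ Metric.closedBall x ε ∧ lapRd v x = ∫ y, u y * lapRd χ y := by
  let b : ContDiffBump (0 : Rd d) := ⟨ε / 2, ε, by positivity, by linarith⟩
  have hsm : ContDiff ℝ (⊤ : ℕ∞) (b.normed volume) := b.contDiff_normed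
  have h2 : ContDiff ℝ 2 (b.normed volume) := b.contDiff_normed (n := 2)
  refine ⟨convolution u (b.normed volume) (lsmul ℝ ℝ).flip volume,
    b.hasCompactSupport_normed.contDiff_convolution_right (n := 2) _ hu.locallyIntegrable h2,
    fun x δ h => ?_, fun x => ⟨fun y => b.normed volume (x - y), ?_, ?_, ?_, ?_, ?_⟩⟩
  · rw [convolution_flip, ← Real.dist_eq]
    exact b.dist_normed_convolution_le hu.aestronglyMeasurable
      fun y hy => h y (Metric.ball_subset_closedBall hy)
  · exact hsm.comp (contDiff_const.sub contDiff_id)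
  · exact b.hasCompactSupport_normed.comp_homeomorph (Homeomorph.subLeft x)
  · exact fun y => b.nonneg_normed _
  · refine closure_minimal (fun y hy => ?_) Metric.isClosed_closedBall
    have : x - y ∈ Function.support (b.normed volume) := hy
    rw [b.support_normed_eq] at this
    rw [Metric.mem_closedBall, dist_comm, dist_eq_norm]
    simpa using (mem_ball_zero_iff.1 this).le
  · exact lapRd_convolution hu h2 b.hasCompactSupport_normed x

end Mollification

/-! ### One-sided Laplacian bounds above an obstacle -/

section Obstacle

variable {d : ℕ}

/-- Distributional subharmonicity on a set. -/
def IsWeaklySubharmonicOn (u : Rd d → ℝ) (S : Set (Rd d)) : Prop :=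
  ∀ χ : Rd d → ℝ, ContDiff ℝ (⊤ : ℕ∞) χ → HasCompactSupport χ → (∀ x, 0 ≤ χ x) →
    tsupport χ ⊆ S → 0 ≤ ∫ x : Rd d, u x * lapRd χ x

/-- A smooth convex approximation of the positive part. -/
def smoothPosPart (t : ℝ) : ℝ := ∫ s in (0 : ℝ)..t, smoothTransition s

lemma hasDerivAt_smoothPosPart (t : ℝ) : HasDerivAt smoothPosPart (smoothTransition t) t :=
  smoothTransition.continuous.integral_hasStrictDerivAt 0 t |>.hasDerivAt

lemma smoothPosPart_zero : smoothPosPart 0 = 0 := intervalIntegral.integral_same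

lemma smoothPosPart_monotone : Monotone smoothPosPart :=
  monotone_of_hasDerivAt_nonneg hasDerivAt_smoothPosPart fun t => smoothTransition.nonneg t

lemma antitone_smoothPosPart_sub_id : Antitone fun t => smoothPosPart t - t :=
  antitone_of_hasDerivAt_nonpos (fun t => (hasDerivAt_smoothPosPart t).sub (hasDerivAt_id t))
    fun t => sub_nonpos.2 (smoothTransition.le_one t)

lemma smoothPosPart_of_nonpos {t : ℝ} (ht : t ≤ 0) : smoothPosPart t = 0 := by
  rw [smoothPosPart, intervalIntegral.integral_congr (g := fun _ => (0 : ℝ))]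
  · simp
  · intro s hs
    rw [Set.uIcc_of_ge ht] at hs
    exact smoothTransition.zero_of_nonpos hs.2

lemma sub_one_le_smoothPosPart (t : ℝ) : t - 1 ≤ smoothPosPart t := by
  rcases le_total t 1 with h | h
  · have h1 := antitone_smoothPosPart_sub_id h
    have h2 := smoothPosPart_monotone (zero_le_one (α := ℝ))
    simp only [smoothPosPart_zero] at h1 h2
    linarith
  · have h1 : smoothPosPart t = smoothPosPart 1 + (t - 1) := by
      rw [smoothPosPart, smoothPosPart, ← intervalIntegral.integral_add_adjacent_intervals
        (smoothTransition.continuous.intervalIntegrable 0 1)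
        (smoothTransition.continuous.intervalIntegrable 1 t)]
      congr 1
      rw [intervalIntegral.integral_congr (g := fun _ => (1 : ℝ))]
      · simp
      · intro s hs
        rw [Set.uIcc_of_le h] at hs
        exact smoothTransition.one_of_one_le hs.1
    have h2 := smoothPosPart_monotone (zero_le_one (α := ℝ))
    rw [smoothPosPart_zero] at h2
    linarith

lemma abs_smoothPosPart_sub_le {s : ℝ} (hs : -2 ≤ s) : |smoothPosPart s - (s + 1)| ≤ 2 := by
  rw [abs_le]
  refine ⟨by linarith [sub_one_le_smoothPosPart s], ?_⟩
  rcases le_total s 0 with h | h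
  · rw [smoothPosPart_of_nonpos h]
    linarith
  · have := antitone_smoothPosPart_sub_id h
    simp only [smoothPosPart_zero] at this
    linarith

/-- The function `t ↦ δ * smoothPosPart (t / δ - 1)`, an approximation of the positive part up to
`2 * δ`. -/
def scaledPosPart (δ t : ℝ) : ℝ := δ * smoothPosPart (t / δ - 1)

lemma hasDerivAt_scaledPosPart {δ : ℝ} (hδ : 0 < δ) (t : ℝ) :
    HasDerivAt (scaledPosPart δ) (smoothTransition (t / δ - 1)) t := by
  have h1 : HasDerivAt (fun t : ℝ => t / δ - 1) (1 / δ) t :=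
    ((hasDerivAt_id t).div_const δ).sub_const 1
  refine (((hasDerivAt_smoothPosPart (t / δ - 1)).comp t h1).const_mul δ).congr_deriv ?_
  field_simp

lemma abs_scaledPosPart_sub_le {δ t : ℝ} (hδ : 0 < δ) (ht : -δ ≤ t) :
    |scaledPosPart δ t - t| ≤ 2 * δ := by
  have h1 : -2 ≤ t / δ - 1 := by
    have : -1 ≤ t / δ := by rw [le_div_iff₀ hδ]; linarith
    linarith
  have h2 : scaledPosPart δ t - t = δ * (smoothPosPart (t / δ - 1) - (t / δ - 1 + 1)) := by
    rw [scaledPosPart]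
    field_simp
    ring
  rw [h2, abs_mul, abs_of_pos hδ]
  nlinarith [abs_smoothPosPart_sub_le h1]

lemma contDiff_scaledPosPart {δ : ℝ} (hδ : 0 < δ) : ContDiff ℝ 2 (scaledPosPart δ) := by
  have h : ContDiff ℝ (1 + 1) (scaledPosPart δ) := by
    rw [contDiff_succ_iff_deriv]
    refine ⟨fun t => (hasDerivAt_scaledPosPart hδ t).differentiableAt, by simp, ?_⟩
    rw [show deriv (scaledPosPart δ) = fun t => smoothTransition (t / δ - 1) from
      funext fun t => (hasDerivAt_scaledPosPart hδ t).deriv]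
    exact (smoothTransition.contDiff (n := 1)).comp
      ((contDiff_id.div_const δ).sub contDiff_const)
  exact h.of_le (by norm_num [one_add_one_eq_two])

/-- The Laplacian of a convex combination of the form `φ + f ∘ (U - φ)`. -/
lemma le_lapRd_add_comp_sub {φ U : Rd d → ℝ} (hφ : ContDiff ℝ 2 φ) (hU : ContDiff ℝ 2 U)
    {f f' f'' : ℝ → ℝ} (hf : ∀ t, HasDerivAt f (f' t) t) (hf' : ∀ t, HasDerivAt f' (f'' t) t)
    (hf'' : ∀ t, 0 ≤ f'' t) (x : Rd d) :
    (1 - f' (U x - φ x)) * lapRd φ x + f' (U x - φ x) * lapRd U x ≤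
      lapRd (fun y => φ y + f (U y - φ y)) x := by
  have hφd := hφ.differentiable (by norm_num)
  have hUd := hU.differentiable (by norm_num)
  have hw : ∀ y, HasFDerivAt (fun y => U y - φ y) (fderiv ℝ U y - fderiv ℝ φ y) y := fun y =>
    (hUd y).hasFDerivAt.sub (hφd y).hasFDerivAt
  have h1 : ∀ y e, fderiv ℝ (fun y => φ y + f (U y - φ y)) y e =
      fderiv ℝ φ y e + f' (U y - φ y) * (fderiv ℝ U y e - fderiv ℝ φ y e) := fun y e => by
    have h := (hφd y).hasFDerivAt.add ((hf (U y - φ y)).comp_hasFDerivAt y (hw y))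
    rw [show (fun y => φ y + f (U y - φ y)) = φ + f ∘ fun y => U y - φ y from rfl, h.fderiv]
    simp
  unfold lapRd
  rw [Finset.mul_sum, Finset.mul_sum, ← Finset.sum_add_distrib]
  refine Finset.sum_le_sum fun j _ => ?_
  set e : Rd d := EuclideanSpace.single j (1 : ℝ)
  simp_rw [h1]
  have hd : ∀ {g : Rd d → ℝ}, ContDiff ℝ 2 g → DifferentiableAt ℝ (fun y => fderiv ℝ g y e) x := by
    intro g hg
    have hg1 : ContDiff ℝ 1 (fderiv ℝ g) := hg.fderiv_right (by norm_num)
    have : ContDiff ℝ 1 fun y => fderiv ℝ g y e := hg1.clm_apply contDiff_const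
    exact this.differentiable (by norm_num) x
  have h2 := (hd hφ).hasFDerivAt.add (((hf' (U x - φ x)).comp_hasFDerivAt x (hw x)).mul
    ((hd hU).hasFDerivAt.sub (hd hφ).hasFDerivAt))
  have h3 : fderiv ℝ (fun y => fderiv ℝ φ y e +
      f' (U y - φ y) * (fderiv ℝ U y e - fderiv ℝ φ y e)) x e = _ :=
    congrArg (fun L => L e) h2.fderiv
  rw [h3]
  simp only [_root_.add_apply, _root_.smul_apply,
    _root_.sub_apply, Function.comp_apply, smul_eq_mul, Pi.sub_apply]
  nlinarith [mul_nonneg (hf'' (U x - φ x)) (sq_nonneg (fderiv ℝ U x e - fderiv ℝ φ x e))]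

/-- If `|u - v| ≤ η` on the closed ball then the kernel averages are `η`-close. -/
lemma abs_integral_sub_integral_le {u v : Rd d → ℝ} (hu : Continuous u) (hv : Continuous v)
    {η r : ℝ} (hr : 0 ≤ r) (x : Rd d) (h : ∀ y ∈ Metric.closedBall x r, |v y - u y| ≤ η) :
    |(∫ y, v (x + r • y) * radialKernel y) - ∫ y, u (x + r • y) * radialKernel y| ≤
      η * ∫ y : Rd d, radialKernel y := by
  have haff : Continuous fun y : Rd d => x + r • y := by fun_prop
  have hi : ∀ {f : Rd d → ℝ}, Continuous f → Integrable fun y => f (x + r • y) * radialKernel y :=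
    fun hf => integrable_mul_radialKernel (hf.comp haff)
  rw [← integral_sub (hi hv) (hi hu), ← integral_const_mul]
  have hbound : Integrable fun y : Rd d => η * radialKernel y :=
    integrable_mul_radialKernel continuous_const
  rw [← Real.norm_eq_abs]
  refine norm_integral_le_of_norm_le hbound (Filter.Eventually.of_forall fun y => ?_)
  rw [← sub_mul, norm_mul, Real.norm_of_nonneg (radialKernel_nonneg y), Real.norm_eq_abs]
  rcases le_total 1 ‖y‖ with hy | hy
  · simp [radialKernel_eq_zero hy]
  · refine mul_le_mul_of_nonneg_right (h _ ?_) (radialKernel_nonneg y)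
    rw [Metric.mem_closedBall, dist_self_add_left, norm_smul, Real.norm_of_nonneg hr]
    exact mul_le_of_le_one_right hr hy

/-- Passing to the limit in the mean value inequality. -/
lemma mul_integral_radialKernel_sub_le_of_approx {u : Rd d → ℝ} (hu : Continuous u) {C r : ℝ}
    (hr : 0 ≤ r) (x : Rd d)
    (h : ∀ η > 0, ∃ v : Rd d → ℝ, ContDiff ℝ 2 v ∧
      ∀ y ∈ Metric.closedBall x r, |v y - u y| ≤ η ∧ -C ≤ lapRd v y) :
    u x * (∫ y : Rd d, radialKernel y) - C * (∫ y : Rd d, radialPotential y) * r ^ 2 / 2 ≤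
      ∫ y, u (x + r • y) * radialKernel y := by
  have hZ := integral_radialKernel_pos (d := d)
  refine le_of_forall_pos_le_add fun η hη => ?_
  obtain ⟨v, hv, hv'⟩ := h (η / (2 * ∫ y : Rd d, radialKernel y)) (by positivity)
  have h1 := mul_integral_radialKernel_sub_le hv hr x fun y hy => (hv' y hy).2
  have h2 := abs_le.1 (abs_integral_sub_integral_le hu hv.continuous hr x
    fun y hy => (hv' y hy).1)
  have h3 := (abs_le.1 (hv' x (Metric.mem_closedBall_self hr)).1).1
  have h4 : η / (2 * ∫ y : Rd d, radialKernel y) * (∫ y : Rd d, radialKernel y) = η / 2 := by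
    field_simp
  nlinarith [h2.2]

/-- Above a `C²` obstacle with Laplacian bounded below, a function that is subharmonic off the
contact set satisfies the corresponding mean value inequality everywhere. -/
lemma mean_value_of_lower_obstacle {u φ : Rd d → ℝ} (hu : UniformContinuous u)
    (hφu : UniformContinuous φ) (hφ : ContDiff ℝ 2 φ) {C : ℝ} (hC : 0 ≤ C)
    (hlap : ∀ x, -C ≤ lapRd φ x) (hle : ∀ x, φ x ≤ u x)
    (hsub : IsWeaklySubharmonicOn u {x | φ x < u x}) {r : ℝ} (hr : 0 ≤ r) (x : Rd d) :
    u x * (∫ y : Rd d, radialKernel y) - C * (∫ y : Rd d, radialPotential y) * r ^ 2 / 2 ≤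
      ∫ y, u (x + r • y) * radialKernel y := by
  refine mul_integral_radialKernel_sub_le_of_approx hu.continuous hr x fun η hη => ?_
  set δ := η / 3 with hδ
  have hδ0 : 0 < δ := by positivity
  obtain ⟨ε₁, hε₁, h₁⟩ := Metric.uniformContinuous_iff.1 hu (δ / 4) (by positivity)
  obtain ⟨ε₂, hε₂, h₂⟩ := Metric.uniformContinuous_iff.1 hφu (δ / 4) (by positivity)
  set ε := min ε₁ ε₂ / 2 with hε
  have hm : 0 < min ε₁ ε₂ := lt_min hε₁ hε₂
  have hε0 : 0 < ε := by positivity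
  have hεlt : ε < min ε₁ ε₂ := by linarith
  have hu' : ∀ x, ∀ y ∈ Metric.closedBall x ε, |u y - u x| ≤ δ / 4 := fun x y hy =>
    (h₁ ((Metric.mem_closedBall.1 hy).trans_lt (hεlt.trans_le (min_le_left _ _)))).le
  have hφ' : ∀ x, ∀ y ∈ Metric.closedBall x ε, |φ y - φ x| ≤ δ / 4 := fun x y hy =>
    (h₂ ((Metric.mem_closedBall.1 hy).trans_lt (hεlt.trans_le (min_le_right _ _)))).le
  obtain ⟨U, hU, hUu, hUlap⟩ := exists_mollification hu.continuous hε0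
  refine ⟨fun y => φ y + scaledPosPart δ (U y - φ y),
    hφ.add ((contDiff_scaledPosPart hδ0).comp (hU.sub hφ)), fun y _ => ⟨?_, ?_⟩⟩
  · have h1 := abs_le.1 (hUu y _ (hu' y))
    have h2 := abs_le.1 (abs_scaledPosPart_sub_le (t := U y - φ y) hδ0 (by linarith [hle y]))
    rw [abs_le]
    constructor <;> linarith
  · have hf' : ∀ t, HasDerivAt (fun t => smoothTransition (t / δ - 1))
        (deriv (fun t => smoothTransition (t / δ - 1)) t) t := fun t => by
      have : ContDiff ℝ 1 fun t : ℝ => smoothTransition (t / δ - 1) :=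
        (smoothTransition.contDiff (n := 1)).comp ((contDiff_id.div_const δ).sub contDiff_const)
      exact (this.differentiable (by norm_num) t).hasDerivAt
    have hmono : Monotone fun t : ℝ => smoothTransition (t / δ - 1) := fun a b hab =>
      smoothTransition.monotone (by gcongr)
    refine le_trans ?_ (le_lapRd_add_comp_sub hφ hU (hasDerivAt_scaledPosPart hδ0) hf'
      (fun t => hmono.deriv_nonneg) y)
    have hs0 := smoothTransition.nonneg ((U y - φ y) / δ - 1)
    have hs1 := smoothTransition.le_one ((U y - φ y) / δ - 1)
    rcases le_or_gt (U y - φ y) δ with h | h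
    · rw [smoothTransition.zero_of_nonpos (by rw [sub_nonpos, div_le_one hδ0]; exact h)]
      linarith [hlap y]
    · obtain ⟨χ, hχ1, hχ2, hχ3, hχ4, hχ5⟩ := hUlap y
      have hpos : 0 ≤ lapRd U y := by
        rw [hχ5]
        refine hsub χ hχ1 hχ2 hχ3 fun z hz => ?_
        have h1 := abs_le.1 (hUu y _ (hu' y))
        have h2 := abs_le.1 (hu' y z (hχ4 hz))
        have h3 := abs_le.1 (hφ' y z (hχ4 hz))
        show φ z < u z
        linarith
      nlinarith [hlap y]

/-- Mean value inequality on a ball where the function is weakly subharmonic. -/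
lemma mean_value_of_subharmonicOn {u : Rd d → ℝ} (hu : UniformContinuous u) {R r : ℝ}
    (hr : 0 ≤ r) (hrR : r < R) {x : Rd d} (hsub : IsWeaklySubharmonicOn u (Metric.ball x R)) :
    u x * (∫ y : Rd d, radialKernel y) ≤ ∫ y, u (x + r • y) * radialKernel y := by
  have := mul_integral_radialKernel_sub_le_of_approx hu.continuous (C := 0) hr x fun η hη => ?_
  · simpa using this
  obtain ⟨ε₁, hε₁, h₁⟩ := Metric.uniformContinuous_iff.1 hu η hη
  set ε := min ε₁ (R - r) / 2 with hε
  have hm : 0 < min ε₁ (R - r) := lt_min hε₁ (by linarith)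
  have hε0 : 0 < ε := by positivity
  have hεlt : ε < min ε₁ (R - r) := by linarith
  obtain ⟨U, hU, hUu, hUlap⟩ := exists_mollification hu.continuous hε0
  refine ⟨U, hU, fun y hy => ⟨hUu y _ fun z hz => ?_, ?_⟩⟩
  · exact (h₁ ((Metric.mem_closedBall.1 hz).trans_lt (hεlt.trans_le (min_le_left _ _)))).le
  · obtain ⟨χ, hχ1, hχ2, hχ3, hχ4, hχ5⟩ := hUlap y
    rw [hχ5, neg_zero]
    refine hsub χ hχ1 hχ2 hχ3 fun z hz => ?_
    have h1 := Metric.mem_closedBall.1 (hχ4 hz)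
    have h2 := Metric.mem_closedBall.1 hy
    have h3 := dist_triangle z y x
    have h4 := min_le_right ε₁ (R - r)
    rw [Metric.mem_ball]
    linarith

end Obstacle

/-! ### Quadratic growth at contact points -/

section Growth

variable {d : ℕ}

lemma integral_clm_mul_radialKernel (L : Rd d →L[ℝ] ℝ) : ∫ y, L y * radialKernel y = 0 := by
  have h := integral_neg_eq_self (fun y => L y * radialKernel y) (volume : Measure (Rd d))
  simp only [map_neg, radialKernel_neg, neg_mul, integral_neg] at h
  linarith

/-- The kernel average reproduces affine functions. -/
lemma integral_sub_affine_mul_radialKernel {u : Rd d → ℝ} (hu : Continuous u)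
    (L : Rd d →L[ℝ] ℝ) (a : ℝ) (x z : Rd d) (r : ℝ) :
    ∫ y, (u (x + r • y) - a - L (x + r • y - z)) * radialKernel y =
      (∫ y, u (x + r • y) * radialKernel y) -
        (a + L (x - z)) * ∫ y : Rd d, radialKernel y := by
  have h1 : Integrable fun y => u (x + r • y) * radialKernel y :=
    integrable_mul_radialKernel (hu.comp (by fun_prop))
  have h2 : Integrable fun y : Rd d => (a + L (x - z)) * radialKernel y :=
    integrable_mul_radialKernel continuous_const
  have h3 : Integrable fun y : Rd d => r * (L y * radialKernel y) :=
    (integrable_mul_radialKernel L.continuous).const_mul r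
  calc _ = ∫ y, (u (x + r • y) * radialKernel y - (a + L (x - z)) * radialKernel y) -
        r * (L y * radialKernel y) := by
        congr 1
        ext y
        simp only [map_sub, map_add, map_smul, smul_eq_mul]
        ring
    _ = _ := by
        rw [integral_sub (by exact h1.sub h2) h3, integral_sub h1 h2, integral_const_mul,
          integral_const_mul, integral_clm_mul_radialKernel, mul_zero, sub_zero]

/-- A Harnack type comparison of kernel averages at nearby centres. -/
lemma exists_integral_le_integral : ∃ A : ℝ, 0 < A ∧ ∀ (W : Rd d → ℝ) (x z : Rd d),
    Continuous W → x ≠ z → (∀ y ∈ Metric.closedBall z (3 * ‖x - z‖), 0 ≤ W y) →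
      ∫ y, W (x + ‖x - z‖ • y) * radialKernel y ≤
        A * ∫ y, W (z + (3 * ‖x - z‖) • y) * radialKernel y := by
  obtain ⟨c, hc, hcle⟩ := exists_le_radialKernel (d := d)
  obtain ⟨K, hK, hKle⟩ := exists_radialKernel_le (d := d)
  refine ⟨K / c * 3 ^ d, by positivity, fun W x z hW hxz hpos => ?_⟩
  set r := ‖x - z‖ with hr
  have hr0 : 0 < r := norm_pos_iff.2 (sub_ne_zero.2 hxz)
  set p : Rd d := (3 * r)⁻¹ • (x - z) with hp
  have hpn : ‖p‖ = 1 / 3 := by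
    rw [hp, norm_smul, ← hr, Real.norm_of_nonneg (by positivity)]
    field_simp
  have hsub : ∀ y : Rd d, z + (3 * r) • (p + (1 / 3 : ℝ) • y) = x + r • y := fun y => by
    rw [hp, smul_add, smul_smul, smul_smul, mul_inv_cancel₀ (by positivity), one_smul,
      show 3 * r * (1 / 3) = r by ring]
    abel
  have hchange : (3 : ℝ) ^ d * ∫ y, W (z + (3 * r) • y) * radialKernel y =
      ∫ y, W (x + r • y) * radialKernel (p + (1 / 3 : ℝ) • y) := by
    have h1 := integral_add_left_eq_self (μ := (volume : Measure (Rd d)))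
      (fun y => W (z + (3 * r) • y) * radialKernel y) p
    have h2 := Measure.integral_comp_smul (volume : Measure (Rd d))
      (fun y => W (z + (3 * r) • (p + y)) * radialKernel (p + y)) (1 / 3 : ℝ)
    simp only [hsub] at h2
    rw [h2, h1, smul_eq_mul, finrank_euclideanSpace_fin]
    congr 1
    rw [abs_of_nonneg (by positivity)]
    simp
  have hkey : c / K * ∫ y, W (x + r • y) * radialKernel y ≤
      ∫ y, W (x + r • y) * radialKernel (p + (1 / 3 : ℝ) • y) := by
    have hi1 : Integrable fun y => W (x + r • y) * radialKernel y :=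
      integrable_mul_radialKernel (hW.comp (by fun_prop))
    rw [← integral_const_mul]
    refine integral_mono (hi1.const_mul _) ?_ fun y => ?_
    · refine integrable_mul_of_hasCompactSupport (hW.comp (by fun_prop))
        (radialKernel_contDiff.continuous.comp (by fun_prop)) ?_
      exact radialKernel_hasCompactSupport.comp_homeomorph
        ((Homeomorph.smulOfNeZero (1 / 3 : ℝ) (by norm_num)).trans (Homeomorph.addLeft p))
    · have hk0 := radialKernel_nonneg y
      have hW0 : ‖p + (1 / 3 : ℝ) • y‖ ≤ 1 → 0 ≤ W (x + r • y) := fun h => by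
        refine hpos _ ?_
        rw [← hsub, Metric.mem_closedBall, dist_self_add_left, norm_smul,
          Real.norm_of_nonneg (by positivity)]
        exact mul_le_of_le_one_right (by positivity) h
      have hcomp : c / K * radialKernel y ≤ radialKernel (p + (1 / 3 : ℝ) • y) := by
        rcases le_total 1 ‖y‖ with hy | hy
        · rw [radialKernel_eq_zero hy, mul_zero]
          exact radialKernel_nonneg _
        · have h1 : ‖p + (1 / 3 : ℝ) • y‖ ≤ 2 / 3 := by
            refine (norm_add_le _ _).trans ?_
            rw [hpn, norm_smul, Real.norm_of_nonneg (by norm_num)]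
            linarith
          refine le_trans ?_ (hcle _ h1)
          rw [div_mul_eq_mul_div, div_le_iff₀ hK]
          exact mul_le_mul_of_nonneg_left (hKle y) hc.le
      show c / K * (W (x + r • y) * radialKernel y) ≤ _
      rcases le_total 1 ‖p + (1 / 3 : ℝ) • y‖ with h | h
      · have h0 : radialKernel (p + (1 / 3 : ℝ) • y) = 0 := radialKernel_eq_zero h
        rw [h0] at hcomp ⊢
        have : radialKernel y = 0 := by
          have hcK : 0 < c / K := by positivity
          nlinarith
        rw [this]
        simp
      · nlinarith [hW0 h]
  rw [mul_assoc, hchange]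
  calc ∫ y, W (x + r • y) * radialKernel y
      = K / c * (c / K * ∫ y, W (x + r • y) * radialKernel y) := by field_simp
    _ ≤ _ := by gcongr

/-- If both mean value inequalities hold up to `C * r ^ 2` and `u` lies above a downward paraboloid
touching at `z`, then `u` is within a paraboloid of its tangent plane at `z`. -/
lemma exists_quadratic_growth {u : Rd d → ℝ} (hu : Continuous u) {C M : ℝ} (hC : 0 ≤ C)
    (hM : 0 ≤ M)
    (hlow : ∀ x r, 0 ≤ r → u x * (∫ y : Rd d, radialKernel y) - C * r ^ 2 ≤
      ∫ y, u (x + r • y) * radialKernel y)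
    (hup : ∀ x r, 0 ≤ r → ∫ y, u (x + r • y) * radialKernel y ≤
      u x * (∫ y : Rd d, radialKernel y) + C * r ^ 2) :
    ∃ C₁ : ℝ, 0 ≤ C₁ ∧ ∀ (z : Rd d) (L : Rd d →L[ℝ] ℝ),
      (∀ y, -(M * ‖y - z‖ ^ 2) ≤ u y - u z - L (y - z)) →
        ∀ y, |u y - u z - L (y - z)| ≤ C₁ * ‖y - z‖ ^ 2 := by
  obtain ⟨A, hA, hcmp⟩ := exists_integral_le_integral (d := d)
  have hZ := integral_radialKernel_pos (d := d)
  set Z := ∫ y : Rd d, radialKernel y with hZdef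
  refine ⟨(A * (9 * C + 9 * M * Z) + C) / Z + M, by positivity, fun z L hL x => ?_⟩
  rcases eq_or_ne x z with rfl | hxz
  · simp
  set r := ‖x - z‖ with hr
  have hr0 : 0 ≤ r := norm_nonneg _
  have haff : ∀ (b : Rd d) (t : ℝ),
      ∫ y, (u (b + t • y) - (u z - 9 * M * r ^ 2) - L (b + t • y - z)) * radialKernel y =
      (∫ y, u (b + t • y) * radialKernel y) - (u z - 9 * M * r ^ 2 + L (b - z)) * Z :=
    fun b t => integral_sub_affine_mul_radialKernel hu L _ b z t
  have h1 := hcmp (fun y => u y - (u z - 9 * M * r ^ 2) - L (y - z)) x z (by fun_prop) hxz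
    fun y hy => by
      have h2 := hL y
      have h3 : ‖y - z‖ ≤ 3 * r := by simpa [dist_eq_norm] using hy
      have h4 : ‖y - z‖ ^ 2 ≤ 9 * r ^ 2 := by nlinarith [norm_nonneg (y - z)]
      nlinarith
  rw [← hr] at h1
  rw [haff, haff, sub_self, map_zero] at h1
  have h2 := hlow x r hr0
  have h3 := hup z (3 * r) (by positivity)
  have h4 : A * ((∫ y, u (z + (3 * r) • y) * radialKernel y) - (u z - 9 * M * r ^ 2 + 0) * Z) ≤
      A * ((9 * C + 9 * M * Z) * r ^ 2) := by
    refine mul_le_mul_of_nonneg_left ?_ hA.le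
    nlinarith
  have h5 : (u x - u z - L (x - z)) * Z ≤ (A * (9 * C + 9 * M * Z) + C) * r ^ 2 := by
    nlinarith [mul_nonneg (mul_nonneg hM (sq_nonneg r)) hZ.le]
  have h6 : u x - u z - L (x - z) ≤ (A * (9 * C + 9 * M * Z) + C) / Z * r ^ 2 := by
    rw [div_mul_eq_mul_div, le_div_iff₀ hZ]
    exact h5
  have h7 := hL x
  have h8 : 0 ≤ (A * (9 * C + 9 * M * Z) + C) / Z * r ^ 2 := by positivity
  have h9 : 0 ≤ M * r ^ 2 := by positivity
  rw [← hr] at h7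
  rw [abs_le]
  constructor <;> linarith

end Growth

/-! ### Second order expansion away from the contact set -/

section MeanValueTaylor

variable {d : ℕ}

lemma fderiv_radialKernel_eq_zero {y : Rd d} (hy : 1 < ‖y‖) : fderiv ℝ radialKernel y = 0 := by
  have h : (radialKernel : Rd d → ℝ) =ᶠ[nhds y] fun _ => 0 := by
    filter_upwards [continuous_norm.continuousAt.eventually (lt_mem_nhds hy)] with z hz
    exact radialKernel_eq_zero (le_of_lt hz)
  rw [h.fderiv_eq]
  simp

/-- A function with the mean value property on a ball of radius `2 * r` has a second order
expansion at the centre, controlled by its deviation from an affine function. -/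
lemma exists_taylor_of_mean_value : ∃ A : ℝ, 0 ≤ A ∧
    ∀ (u : Rd d → ℝ) (x : Rd d) (r a C₁ : ℝ) (L : Rd d →L[ℝ] ℝ), Continuous u → 0 < r → 0 ≤ C₁ →
      (∀ y, ‖y - x‖ ≤ 2 * r →
        u y * (∫ η : Rd d, radialKernel η) = ∫ η, u (y + r • η) * radialKernel η) →
      (∀ y, |u y - a - L (y - x)| ≤ C₁ * (‖y - x‖ + 4 * r) ^ 2) →
      ∃ l : Rd d →L[ℝ] ℝ, ∀ y, |u y - u x - l (y - x)| ≤ A * C₁ * ‖y - x‖ ^ 2 := by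
  have hk := radialKernel_contDiff (d := d)
  have hDc : Continuous (fderiv ℝ (radialKernel (d := d))) := hk.continuous_fderiv (by norm_num)
  have hDs : HasCompactSupport (fderiv ℝ (radialKernel (d := d))) :=
    radialKernel_hasCompactSupport.fderiv ℝ
  obtain ⟨M, hM, hMle⟩ := exists_taylor_of_hasCompactSupport hk radialKernel_hasCompactSupport
  have hZ := integral_radialKernel_pos (d := d)
  set Z := ∫ y : Rd d, radialKernel y with hZdef
  set D := ∫ y : Rd d, ‖fderiv ℝ radialKernel y‖ with hD
  have hDi : Integrable fun y : Rd d => ‖fderiv ℝ radialKernel y‖ :=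
    (hDc.integrable_of_hasCompactSupport hDs).norm
  have hD0 : 0 ≤ D := integral_nonneg fun y => norm_nonneg _
  set V := (volume : Measure (Rd d)).real (Metric.closedBall 0 3) with hV
  have hV0 : 0 ≤ V := measureReal_nonneg
  refine ⟨49 * M * V / Z + (13 + 13 * D / Z), by positivity,
    fun u x r a C₁ L hu hr hC₁ hmv hbd => ?_⟩
  set w : Rd d → ℝ := fun y => u y - a - L (y - x) with hw
  have hwc : Continuous w := by fun_prop
  have hwbd : ∀ y, |w (x + r • y)| ≤ C₁ * (r * ‖y‖ + 4 * r) ^ 2 := fun y => by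
    have := hbd (x + r • y)
    rwa [show ‖x + r • y - x‖ = r * ‖y‖ by
      rw [add_sub_cancel_left, norm_smul, Real.norm_of_nonneg hr.le]] at this
  have hwmv : ∀ y, ‖y - x‖ ≤ 2 * r → w y * Z = ∫ η, w (y + r • η) * radialKernel η :=
    fun y hy => by
      have h1 := integral_sub_affine_mul_radialKernel hu L a y x r
      have h2 := hmv y hy
      simp only [hw]
      rw [h1, ← h2]
      ring
  have hwtr : ∀ h : Rd d, ‖h‖ ≤ 2 * r →
      w (x + h) * Z = ∫ y, w (x + r • y) * radialKernel (y - r⁻¹ • h) := fun h hh => by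
    rw [hwmv (x + h) (by simpa using hh), ← integral_sub_right_eq_self _ (r⁻¹ • h)]
    congr 1
    ext y
    rw [smul_sub, smul_smul, mul_inv_cancel₀ hr.ne', one_smul]
    congr 2
    abel
  have hBi : Integrable fun y => w (x + r • y) • fderiv ℝ radialKernel y :=
    (Continuous.smul (hwc.comp (by fun_prop)) hDc).integrable_of_hasCompactSupport hDs.smul_left
  set l₀ : Rd d →L[ℝ] ℝ := -((Z * r)⁻¹ • ∫ y, w (x + r • y) • fderiv ℝ radialKernel y) with hl₀
  have hl₀h : ∀ h : Rd d, l₀ h =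
      -((Z * r)⁻¹ * ∫ y, w (x + r • y) * fderiv ℝ radialKernel y h) := fun h => by
    rw [hl₀]
    simp only [_root_.neg_apply, _root_.smul_apply, smul_eq_mul]
    rw [ContinuousLinearMap.integral_apply hBi]
    rfl
  refine ⟨L + l₀, fun y => ?_⟩
  obtain ⟨h, rfl⟩ : ∃ h, y = x + h := ⟨y - x, by abel⟩
  have hred : u (x + h) - u x - (L + l₀) (x + h - x) = w (x + h) - w x - l₀ h := by
    simp only [hw, add_sub_cancel_left, sub_self, map_zero, _root_.add_apply]
    ring
  rw [hred, add_sub_cancel_left]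
  rcases le_total ‖h‖ (2 * r) with hh | hh
  · have hkey : (w (x + h) - w x - l₀ h) * Z = ∫ y, w (x + r • y) *
        (radialKernel (y - r⁻¹ • h) - radialKernel y -
          fderiv ℝ radialKernel y (y - r⁻¹ • h - y)) := by
      have h0 := hwtr 0 (by simpa using hr.le)
      rw [smul_zero, add_zero] at h0
      simp only [sub_zero] at h0
      have hi1 : Integrable fun y => w (x + r • y) * radialKernel (y - r⁻¹ • h) :=
        integrable_mul_of_hasCompactSupport (hwc.comp (by fun_prop))
          (hk.continuous.comp (by fun_prop))
          (radialKernel_hasCompactSupport.comp_homeomorph (Homeomorph.subRight (r⁻¹ • h)))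
      have hi2 : Integrable fun y => w (x + r • y) * radialKernel y :=
        integrable_mul_radialKernel (hwc.comp (by fun_prop))
      have hi3 : Integrable fun y => r⁻¹ * (w (x + r • y) * fderiv ℝ radialKernel y h) :=
        (integrable_mul_of_hasCompactSupport (hwc.comp (by fun_prop))
          (hDc.clm_apply continuous_const)
          (radialKernel_hasCompactSupport.fderiv_apply ℝ h)).const_mul _
      calc _ = w (x + h) * Z - w x * Z +
            r⁻¹ * ∫ y, w (x + r • y) * fderiv ℝ radialKernel y h := by
            rw [hl₀h]
            field_simp
            ring
        _ = ∫ y, (w (x + r • y) * radialKernel (y - r⁻¹ • h) -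
              w (x + r • y) * radialKernel y) +
                r⁻¹ * (w (x + r • y) * fderiv ℝ radialKernel y h) := by
            rw [integral_add (by exact hi1.sub hi2) hi3, integral_sub hi1 hi2, integral_const_mul,
              hwtr h hh, h0]
        _ = _ := by
            congr 1
            ext y
            rw [sub_sub_cancel_left, map_neg, map_smul, smul_eq_mul]
            ring
    have hrh : ‖r⁻¹ • h‖ = ‖h‖ / r := by
      rw [norm_smul, Real.norm_of_nonneg (by positivity), inv_mul_eq_div]
    have hrh2 : ‖h‖ / r ≤ 2 := by rwa [div_le_iff₀ hr]
    have hbound : |(w (x + h) - w x - l₀ h) * Z| ≤ V * (49 * C₁ * M * ‖h‖ ^ 2) := by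
      have hind : Integrable ((Metric.closedBall (0 : Rd d) 3).indicator
          fun _ => 49 * C₁ * M * ‖h‖ ^ 2) :=
        (integrable_indicator_iff measurableSet_closedBall).2
          (integrableOn_const (measure_closedBall_lt_top.ne))
      have := norm_integral_le_of_norm_le (f := fun y => w (x + r • y) *
        (radialKernel (y - r⁻¹ • h) - radialKernel y -
          fderiv ℝ radialKernel y (y - r⁻¹ • h - y))) hind
            (Filter.Eventually.of_forall fun y => ?_)
      · rwa [integral_indicator_const _ measurableSet_closedBall, smul_eq_mul, ← hkey,
          Real.norm_eq_abs] at this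
      rw [norm_mul, Real.norm_eq_abs, Real.norm_eq_abs]
      rcases le_or_gt ‖y‖ 3 with hy | hy
      · rw [Set.indicator_of_mem (by simpa using hy)]
        have h1 := hMle y (y - r⁻¹ • h)
        rw [sub_sub_cancel_left, norm_neg, hrh, ← sub_sub_cancel_left y] at h1
        have h2 : |w (x + r • y)| ≤ C₁ * (7 * r) ^ 2 :=
          (hwbd y).trans (by gcongr; nlinarith)
        calc _ ≤ C₁ * (7 * r) ^ 2 * (M * (‖h‖ / r) ^ 2) := by gcongr
          _ = _ := by field_simp; ring
      · rw [Set.indicator_of_notMem (by simpa using hy), fderiv_radialKernel_eq_zero (by linarith),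
          radialKernel_eq_zero (by linarith : 1 ≤ ‖y‖), radialKernel_eq_zero (y := y - r⁻¹ • h)]
        · simp
        · have := norm_sub_norm_le y (r⁻¹ • h)
          linarith
    rw [abs_mul, abs_of_pos hZ, ← le_div_iff₀ hZ] at hbound
    refine hbound.trans ?_
    have : 0 ≤ (13 + 13 * D / Z) * C₁ * ‖h‖ ^ 2 := by positivity
    calc _ = 49 * M * V / Z * C₁ * ‖h‖ ^ 2 := by ring
      _ ≤ _ := by linarith
  · have h1 : |w (x + h)| ≤ 9 * C₁ * ‖h‖ ^ 2 := by
      have := hbd (x + h)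
      rw [add_sub_cancel_left] at this
      have h2 : (‖h‖ + 4 * r) ^ 2 ≤ (3 * ‖h‖) ^ 2 := by gcongr; linarith
      calc |w (x + h)| ≤ C₁ * (‖h‖ + 4 * r) ^ 2 := by simpa [hw] using this
        _ ≤ C₁ * (3 * ‖h‖) ^ 2 := by gcongr
        _ = _ := by ring
    have h2 : |w x| ≤ 4 * C₁ * ‖h‖ ^ 2 := by
      have := hbd x
      rw [sub_self, norm_zero, zero_add] at this
      have h2 : (4 * r) ^ 2 ≤ (2 * ‖h‖) ^ 2 := pow_le_pow_left₀ (by positivity) (by linarith) 2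
      calc |w x| ≤ C₁ * (4 * r) ^ 2 := by simpa [hw] using this
        _ ≤ C₁ * (2 * ‖h‖) ^ 2 := by gcongr
        _ = _ := by ring
    have h3 : |l₀ h| ≤ 13 * D / Z * C₁ * ‖h‖ ^ 2 := by
      have h4 : |∫ y, w (x + r • y) * fderiv ℝ radialKernel y h| ≤
          ∫ y : Rd d, 25 * C₁ * r ^ 2 * ‖h‖ * ‖fderiv ℝ radialKernel y‖ := by
        rw [← Real.norm_eq_abs]
        refine norm_integral_le_of_norm_le (hDi.const_mul _)
          (Filter.Eventually.of_forall fun y => ?_)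
        rw [norm_mul, Real.norm_eq_abs]
        rcases le_or_gt ‖y‖ 1 with hy | hy
        · have h2 : |w (x + r • y)| ≤ C₁ * (5 * r) ^ 2 :=
            (hwbd y).trans (by gcongr; nlinarith)
          calc _ ≤ C₁ * (5 * r) ^ 2 * (‖fderiv ℝ radialKernel y‖ * ‖h‖) := by
                gcongr
                exact ContinuousLinearMap.le_opNorm _ _
            _ = _ := by ring
        · simp [fderiv_radialKernel_eq_zero hy]
      rw [integral_const_mul, ← hD] at h4
      rw [hl₀h, abs_neg, abs_mul, abs_of_pos (by positivity)]
      calc _ ≤ (Z * r)⁻¹ * (25 * C₁ * r ^ 2 * ‖h‖ * D) := by gcongr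
        _ = 25 * D / Z * C₁ * ‖h‖ * r := by field_simp
        _ ≤ 25 * D / Z * C₁ * ‖h‖ * (‖h‖ / 2) := by gcongr; linarith
        _ ≤ _ := by
          have : 0 ≤ D / Z * C₁ * ‖h‖ ^ 2 := by positivity
          calc _ = 12.5 * (D / Z * C₁ * ‖h‖ ^ 2) := by ring
            _ ≤ 13 * (D / Z * C₁ * ‖h‖ ^ 2) := by gcongr; norm_num
            _ = _ := by ring
    have h5 : |w (x + h) - w x - l₀ h| ≤ |w (x + h)| + |w x| + |l₀ h| :=
      (abs_sub _ _).trans (by gcongr; exact abs_sub _ _)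
    have : 0 ≤ 49 * M * V / Z * C₁ * ‖h‖ ^ 2 := by positivity
    linarith

end MeanValueTaylor

/-! ### Uniform second order expansions imply `C^{1,1}` -/

section Expansion

variable {E : Type*} [NormedAddCommGroup E] [NormedSpace ℝ E]

lemma hasFDerivAt_of_abs_sub_le {u : E → ℝ} {C : ℝ} {x : E} {l : E →L[ℝ] ℝ}
    (h : ∀ y, |u y - u x - l (y - x)| ≤ C * ‖y - x‖ ^ 2) : HasFDerivAt u l x := by
  refine HasFDerivAt.of_isLittleO ?_
  refine Asymptotics.IsBigO.trans_isLittleO (g := fun y => ‖y - x‖ ^ 2)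
    (Asymptotics.IsBigO.of_bound C (Filter.Eventually.of_forall fun y => ?_))
    (Asymptotics.isLittleO_pow_sub_sub x (by norm_num))
  rw [Real.norm_eq_abs, Real.norm_of_nonneg (by positivity)]
  exact h y

lemma contDiff_one_and_lipschitzWith_of_taylor {u : E → ℝ} {C : ℝ} (hC : 0 ≤ C)
    (h : ∀ x, ∃ l : E →L[ℝ] ℝ, ∀ y, |u y - u x - l (y - x)| ≤ C * ‖y - x‖ ^ 2) :
    ContDiff ℝ 1 u ∧ ∃ K : NNReal, LipschitzWith K (fderiv ℝ u) := by
  choose l hl using h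
  have hd : ∀ x, HasFDerivAt u (l x) x := fun x => hasFDerivAt_of_abs_sub_le (hl x)
  have hfd : fderiv ℝ u = l := funext fun x => (hd x).fderiv
  have hlip : LipschitzWith (6 * C).toNNReal (fderiv ℝ u) := by
    rw [hfd]
    refine LipschitzWith.of_dist_le_mul fun x z => ?_
    rw [Real.coe_toNNReal _ (by positivity), dist_eq_norm, dist_eq_norm]
    refine ContinuousLinearMap.opNorm_le_of_unit_norm (by positivity) fun v hv => ?_
    rcases eq_or_ne x z with rfl | hxz
    · simp
    set s := ‖x - z‖ with hs
    have hs0 : 0 < s := norm_pos_iff.2 (sub_ne_zero.2 hxz)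
    have h1 := hl x (x + s • v)
    have h2 := hl z (x + s • v)
    have h3 := hl z x
    have e1 : ‖x + s • v - x‖ = s := by
      rw [add_sub_cancel_left, norm_smul, hv, mul_one, Real.norm_of_nonneg hs0.le]
    have e2 : ‖x + s • v - z‖ ≤ 2 * s := by
      rw [show x + s • v - z = (x + s • v - x) + (x - z) by abel]
      refine (norm_add_le _ _).trans ?_
      rw [e1, ← hs]
      linarith
    have e3 : l z (x + s • v - z) = l z (x - z) + s * l z v := by
      rw [show x + s • v - z = (x - z) + s • v by abel, map_add, map_smul, smul_eq_mul]
    have e4 : l x (x + s • v - x) = s * l x v := by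
      rw [add_sub_cancel_left, map_smul, smul_eq_mul]
    have e5 : C * ‖x + s • v - z‖ ^ 2 ≤ C * (2 * s) ^ 2 := by gcongr
    rw [e1, e4] at h1
    rw [e3] at h2
    rw [← hs] at h3
    rw [_root_.sub_apply, Real.norm_eq_abs, ← mul_le_mul_iff_of_pos_left hs0]
    rw [← abs_of_pos hs0, ← abs_mul, abs_of_pos hs0]
    have h1' := abs_le.1 h1
    have h2' := abs_le.1 (h2.trans e5)
    have h3' := abs_le.1 h3
    rw [abs_le]
    constructor <;> nlinarith
  exact ⟨contDiff_one_iff_fderiv.2 ⟨fun x => (hd x).differentiableAt, hlip.continuous⟩, _, hlip⟩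

end Expansion

/-! ### Periodic functions -/

section Periodic

variable {d : ℕ}

lemma PeriodicRd.add_sum {α : Type*} {f : Rd d → α} (hf : PeriodicRd f) (n : Fin d → ℤ)
    (s : Finset (Fin d)) (x : Rd d) :
    f (x + ∑ j ∈ s, ((n j : ℝ) * (2 * π)) • EuclideanSpace.single j (1 : ℝ)) = f x := by
  have h1 : ∀ (j : Fin d) (m : ℤ) (x : Rd d),
      f (x + ((m : ℝ) * (2 * π)) • EuclideanSpace.single j (1 : ℝ)) = f x := fun j m x => by
    have h : Function.Periodic f ((2 * π) • EuclideanSpace.single j (1 : ℝ)) := fun y => hf y j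
    have h2 := h.zsmul m x
    rwa [← Int.cast_smul_eq_zsmul ℝ, smul_smul] at h2
  induction s using Finset.induction_on generalizing x with
  | empty => simp
  | insert a s ha ih => rw [Finset.sum_insert ha, ← add_assoc, ih, h1]

/-- Every point has a lattice translate in a fixed ball. -/
lemma exists_translate_mem_closedBall (x : Rd d) : ∃ n : Fin d → ℤ,
    x + ∑ j, ((n j : ℝ) * (2 * π)) • EuclideanSpace.single j (1 : ℝ) ∈
      Metric.closedBall (0 : Rd d) (d * (2 * π)) := by
  refine ⟨fun j => -⌊x j / (2 * π)⌋, ?_⟩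
  rw [mem_closedBall_zero_iff]
  have hx : x = ∑ j, x j • EuclideanSpace.single j (1 : ℝ) := by
    conv_lhs => rw [← (EuclideanSpace.basisFun (Fin d) ℝ).sum_repr x]
    simp
  have hsum : x + ∑ j, (((-⌊x j / (2 * π)⌋ : ℤ) : ℝ) * (2 * π)) • EuclideanSpace.single j (1 : ℝ) =
      ∑ j, (x j + ((-⌊x j / (2 * π)⌋ : ℤ) : ℝ) * (2 * π)) • EuclideanSpace.single j (1 : ℝ) := by
    simp only [add_smul, Finset.sum_add_distrib, ← hx]
  rw [hsum]
  refine (norm_sum_le _ _).trans ?_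
  refine (Finset.sum_le_card_nsmul _ _ (2 * π) fun j _ => ?_).trans (by simp)
  rw [norm_smul, PiLp.norm_single, norm_one, mul_one]
  have hp : 0 < 2 * π := by positivity
  have e : x j + ((-⌊x j / (2 * π)⌋ : ℤ) : ℝ) * (2 * π) = Int.fract (x j / (2 * π)) * (2 * π) := by
    rw [Int.fract]
    push_cast
    field_simp
    ring
  rw [e, Real.norm_of_nonneg (mul_nonneg (Int.fract_nonneg _) hp.le)]
  exact mul_le_of_le_one_left hp.le (Int.fract_lt_one _).le

lemma PeriodicRd.exists_bound {F : Type*} [NormedAddCommGroup F] {f : Rd d → F}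
    (hf : PeriodicRd f) (hc : Continuous f) : ∃ B : ℝ, 0 ≤ B ∧ ∀ x, ‖f x‖ ≤ B := by
  obtain ⟨B, hB⟩ := (isCompact_closedBall (0 : Rd d) (d * (2 * π))).exists_bound_of_continuousOn
    hc.continuousOn
  have h : ∀ x, ‖f x‖ ≤ B := fun x => by
    obtain ⟨n, hn⟩ := exists_translate_mem_closedBall x
    rw [← hf.add_sum n Finset.univ x]
    exact hB _ hn
  exact ⟨B, (norm_nonneg _).trans (h 0), h⟩

lemma PeriodicRd.uniformContinuous {f : Rd d → ℝ} (hf : PeriodicRd f) (hc : Continuous f) :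
    UniformContinuous f := by
  have hK := isCompact_closedBall (0 : Rd d) (d * (2 * π) + 1)
  have hu := hK.uniformContinuousOn_of_continuous hc.continuousOn
  rw [Metric.uniformContinuous_iff]
  intro ε hε
  obtain ⟨δ, hδ, h⟩ := Metric.uniformContinuousOn_iff.1 hu ε hε
  refine ⟨min δ 1, lt_min hδ one_pos, fun x y hxy => ?_⟩
  obtain ⟨n, hn⟩ := exists_translate_mem_closedBall x
  rw [← hf.add_sum n Finset.univ x, ← hf.add_sum n Finset.univ y]
  set t := ∑ j, ((n j : ℝ) * (2 * π)) • EuclideanSpace.single j (1 : ℝ)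
  have hd : dist (x + t) (y + t) = dist x y := dist_add_right _ _ _
  refine h _ ?_ _ ?_ ?_
  · exact Metric.closedBall_subset_closedBall (by linarith) hn
  · rw [Metric.mem_closedBall] at hn ⊢
    have h1 := dist_triangle_left (y + t) 0 (x + t)
    have h2 := hxy.trans_le (min_le_right _ _)
    linarith
  · rw [hd]
    exact hxy.trans_le (min_le_left _ _)

lemma PeriodicRd.fderiv {F : Type*} [NormedAddCommGroup F] [NormedSpace ℝ F] {f : Rd d → F}
    (hf : PeriodicRd f) : PeriodicRd (fderiv ℝ f) := fun x j => by
  rw [← fderiv_comp_add_right]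
  congr 1
  ext y
  exact hf y j

lemma PeriodicRd.lapRd {f : Rd d → ℝ} (hf : PeriodicRd f) : PeriodicRd (lapRd f) := fun x j => by
  refine Finset.sum_congr rfl fun i _ => ?_
  have h : PeriodicRd fun y => _root_.fderiv ℝ f y (EuclideanSpace.single i (1 : ℝ)) :=
    fun y j => congrArg (fun L => L (EuclideanSpace.single i (1 : ℝ))) (hf.fderiv y j)
  rw [h.fderiv x j]

lemma PeriodicRd.exists_lipschitzWith {F : Type*} [NormedAddCommGroup F] [NormedSpace ℝ F]
    {f : Rd d → F} (hf : PeriodicRd f) (hc : ContDiff ℝ 1 f) :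
    ∃ K : NNReal, LipschitzWith K f := by
  obtain ⟨B, hB, h⟩ := hf.fderiv.exists_bound (hc.continuous_fderiv (by norm_num))
  exact ⟨⟨B, hB⟩, lipschitzWith_of_nnnorm_fderiv_le (𝕜 := ℝ)
    (hc.differentiable (by norm_num)) fun x => h x⟩

end Periodic

/-! ### Regularity of solutions -/

section Regularity

variable {d : ℕ}

lemma IsWeaklySubharmonicOn.mono {u : Rd d → ℝ} {S T : Set (Rd d)}
    (h : IsWeaklySubharmonicOn u T) (hST : S ⊆ T) : IsWeaklySubharmonicOn u S :=
  fun χ h1 h2 h3 h4 => h χ h1 h2 h3 (h4.trans hST)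

lemma mean_value_of_harmonicOn {u : Rd d → ℝ} (hu : UniformContinuous u) {R r : ℝ}
    (hr : 0 ≤ r) (hrR : r < R) {x : Rd d} (h₁ : IsWeaklySubharmonicOn u (Metric.ball x R))
    (h₂ : IsWeaklySubharmonicOn (fun y => -u y) (Metric.ball x R)) :
    u x * (∫ y : Rd d, radialKernel y) = ∫ y, u (x + r • y) * radialKernel y := by
  refine le_antisymm (mean_value_of_subharmonicOn hu hr hrR h₁) ?_
  have h := mean_value_of_subharmonicOn hu.neg hr hrR h₂
  simp only [neg_mul, integral_neg] at h
  linarith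

lemma IsDOPSolution.isWeaklySubharmonicOn {φm φp u : Rd d → ℝ} (h : IsDOPSolution φm φp u) :
    IsWeaklySubharmonicOn u {x | φm x < u x} := h.2.2.2.1

/-- The problem is invariant under exchanging the obstacles and changing signs. -/
lemma IsDOPSolution.neg {φm φp u : Rd d → ℝ} (h : IsDOPSolution φm φp u) :
    IsDOPSolution (fun x => -φp x) (fun x => -φm x) fun x => -u x := by
  obtain ⟨hc, hp, hle, hsub, hsup⟩ := h
  refine ⟨hc.neg, fun x j => by simp only [hp x j], fun x => ?_, fun χ h1 h2 h3 h4 => ?_,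
    fun χ h1 h2 h3 h4 => ?_⟩
  · exact ⟨neg_le_neg (hle x).2, neg_le_neg (hle x).1⟩
  · have := hsup χ h1 h2 h3 (by simpa using h4)
    simpa [neg_mul, integral_neg] using this
  · have := hsub χ h1 h2 h3 (by simpa using h4)
    simpa [neg_mul, integral_neg] using this

lemma PeriodicRd.neg {f : Rd d → ℝ} (hf : PeriodicRd f) : PeriodicRd fun x => -f x :=
  fun x j => congrArg Neg.neg (hf x j)

lemma IsDOPSolution.exists_mean_value_le {φm φp u : Rd d → ℝ} (h : IsDOPSolution φm φp u)
    (hmreg : ContDiff ℝ 2 φm) (hmper : PeriodicRd φm) :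
    ∃ C : ℝ, 0 ≤ C ∧ ∀ x r, 0 ≤ r → u x * (∫ y : Rd d, radialKernel y) - C * r ^ 2 ≤
      ∫ y, u (x + r • y) * radialKernel y := by
  obtain ⟨B, hB, hlap⟩ := hmper.lapRd.exists_bound (continuous_lapRd hmreg)
  have hP : 0 ≤ ∫ y : Rd d, radialPotential y := integral_nonneg radialPotential_nonneg
  refine ⟨B * (∫ y : Rd d, radialPotential y) / 2, by positivity, fun x r hr => ?_⟩
  have := mean_value_of_lower_obstacle (h.2.1.uniformContinuous h.1)
    (hmper.uniformContinuous hmreg.continuous) hmreg hB (fun x => (abs_le.1 (hlap x)).1)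
    (fun x => (h.2.2.1 x).1) h.isWeaklySubharmonicOn hr x
  linarith

/-- Solutions have uniform second order expansions at contact points with the lower obstacle. -/
lemma IsDOPSolution.exists_taylor_of_lower_contact {φm φp u : Rd d → ℝ}
    (h : IsDOPSolution φm φp u) (hmreg : ContDiff ℝ 2 φm) (hpreg : ContDiff ℝ 2 φp)
    (hmper : PeriodicRd φm) (hpper : PeriodicRd φp) :
    ∃ C : ℝ, 0 ≤ C ∧ ∀ z, u z = φm z → ∃ L : Rd d →L[ℝ] ℝ,
      ∀ y, |u y - u z - L (y - z)| ≤ C * ‖y - z‖ ^ 2 := by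
  obtain ⟨C₁, hC₁, h₁⟩ := h.exists_mean_value_le hmreg hmper
  obtain ⟨C₂, hC₂, h₂⟩ := h.neg.exists_mean_value_le hpreg.neg hpper.neg
  obtain ⟨K, hK⟩ := hmper.fderiv.exists_lipschitzWith (hmreg.fderiv_right (m := 1) (by norm_num))
  obtain ⟨C, hC, hgrowth⟩ := exists_quadratic_growth h.1 (C := C₁ + C₂) (M := K) (by positivity)
    K.2 (fun x r hr => by nlinarith [h₁ x r hr, mul_nonneg hC₂ (sq_nonneg r)])
    (fun x r hr => by
      have := h₂ x r hr
      simp only [neg_mul, integral_neg] at this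
      nlinarith [mul_nonneg hC₁ (sq_nonneg r)])
  refine ⟨C, hC, fun z hz => ⟨fderiv ℝ φm z, hgrowth z _ fun y => ?_⟩⟩
  have h3 := (abs_le.1 (taylor_of_lipschitzWith_fderiv (hmreg.differentiable (by norm_num)) hK z
    y)).1
  have h4 := (h.2.2.1 y).1
  linarith

lemma IsDOPSolution.exists_taylor_of_contact {φm φp u : Rd d → ℝ}
    (h : IsDOPSolution φm φp u) (hmreg : ContDiff ℝ 2 φm) (hpreg : ContDiff ℝ 2 φp)
    (hmper : PeriodicRd φm) (hpper : PeriodicRd φp) :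
    ∃ C : ℝ, 0 ≤ C ∧ ∀ z, u z = φm z ∨ u z = φp z → ∃ L : Rd d →L[ℝ] ℝ,
      ∀ y, |u y - u z - L (y - z)| ≤ C * ‖y - z‖ ^ 2 := by
  obtain ⟨C₁, hC₁, h₁⟩ := h.exists_taylor_of_lower_contact hmreg hpreg hmper hpper
  obtain ⟨C₂, hC₂, h₂⟩ := h.neg.exists_taylor_of_lower_contact hpreg.neg hmreg.neg hpper.neg
    hmper.neg
  refine ⟨max C₁ C₂, le_max_of_le_left hC₁, fun z hz => ?_⟩
  rcases hz with hz | hz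
  · obtain ⟨L, hL⟩ := h₁ z hz
    exact ⟨L, fun y => (hL y).trans (by gcongr; exact le_max_left _ _)⟩
  · obtain ⟨L, hL⟩ := h₂ z (by rw [hz])
    refine ⟨-L, fun y => ?_⟩
    have e : u y - u z - (-L) (y - z) = -(-u y - -u z - L (y - z)) := by
      rw [_root_.neg_apply]
      ring
    rw [e, abs_neg]
    exact (hL y).trans (by gcongr; exact le_max_right _ _)

/-- Solutions have the mean value property away from the contact set. -/
lemma IsDOPSolution.mean_value_of_ball {φm φp u : Rd d → ℝ} (h : IsDOPSolution φm φp u)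
    {x : Rd d} {R : ℝ} (hR : 0 < R)
    (hball : ∀ y ∈ Metric.ball x R, ¬(u y = φm y ∨ u y = φp y)) (y : Rd d)
    (hy : ‖y - x‖ ≤ 2 * (R / 4)) :
    u y * (∫ η : Rd d, radialKernel η) = ∫ η, u (y + (R / 4) • η) * radialKernel η := by
  have hsub : Metric.ball y (R / 2) ⊆ Metric.ball x R :=
    Metric.ball_subset_ball' (by rw [dist_eq_norm]; linarith)
  refine mean_value_of_harmonicOn (h.2.1.uniformContinuous h.1) (by positivity)
    (by linarith : R / 4 < R / 2) (h.isWeaklySubharmonicOn.mono fun z hz => ?_)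
    (h.neg.isWeaklySubharmonicOn.mono fun z hz => ?_)
  · exact lt_of_le_of_ne (h.2.2.1 z).1 fun e => hball z (hsub hz) (Or.inl e.symm)
  · exact neg_lt_neg (lt_of_le_of_ne (h.2.2.1 z).2 fun e => hball z (hsub hz) (Or.inr e))

/-- Solutions have uniform second order expansions at all points. -/
lemma IsDOPSolution.exists_taylor {φm φp u : Rd d → ℝ}
    (h : IsDOPSolution φm φp u) (hmreg : ContDiff ℝ 2 φm) (hpreg : ContDiff ℝ 2 φp)
    (hmper : PeriodicRd φm) (hpper : PeriodicRd φp) :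
    ∃ C : ℝ, 0 ≤ C ∧ ∀ x, ∃ L : Rd d →L[ℝ] ℝ,
      ∀ y, |u y - u x - L (y - x)| ≤ C * ‖y - x‖ ^ 2 := by
  obtain ⟨C, hC, hcontact⟩ := h.exists_taylor_of_contact hmreg hpreg hmper hpper
  obtain ⟨A, hA, hmean⟩ := exists_taylor_of_mean_value (d := d)
  set Λ : Set (Rd d) := {z | u z = φm z ∨ u z = φp z} with hΛ
  have hclosed : IsClosed Λ :=
    (isClosed_eq h.1 hmreg.continuous).union (isClosed_eq h.1 hpreg.continuous)
  rcases Λ.eq_empty_or_nonempty with hempty | hne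
  · obtain ⟨B, hB, hbd⟩ := h.2.1.exists_bound h.1
    refine ⟨A * B, by positivity, fun x => ?_⟩
    refine hmean u x (1 / 4) 0 B 0 h.1 (by norm_num) hB
      (h.mean_value_of_ball one_pos fun y _ hy => ?_)
      fun y => ?_
    · exact Set.eq_empty_iff_forall_notMem.1 hempty y hy
    · have h1 := hbd y
      rw [Real.norm_eq_abs] at h1
      have h2 : 1 ≤ (‖y - x‖ + 4 * (1 / 4)) ^ 2 := by nlinarith [norm_nonneg (y - x)]
      simpa using h1.trans (le_mul_of_one_le_right hB h2)
  · refine ⟨max C (A * C), le_max_of_le_left hC, fun x => ?_⟩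
    by_cases hx : x ∈ Λ
    · obtain ⟨L, hL⟩ := hcontact x hx
      exact ⟨L, fun y => (hL y).trans (by gcongr; exact le_max_left _ _)⟩
    obtain ⟨z, hz, hzd⟩ := hclosed.exists_infDist_eq_dist hne x
    obtain ⟨L, hL⟩ := hcontact z hz
    have hR : 0 < dist x z := dist_pos.2 fun e => hx (e ▸ hz)
    obtain ⟨l, hl⟩ := hmean u x (dist x z / 4) (u z + L (x - z)) C L h.1 (by positivity) hC
      (h.mean_value_of_ball hR fun y hy hyΛ => by
        have h1 := Metric.infDist_le_dist_of_mem (x := x) (show y ∈ Λ from hyΛ)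
        rw [Metric.mem_ball, dist_comm] at hy
        linarith)
      fun y => by
        have h1 := hL y
        have e : L (y - z) = L (x - z) + L (y - x) := by
          rw [← map_add]
          congr 1
          abel
        rw [e] at h1
        rw [show u y - (u z + L (x - z)) - L (y - x) = u y - u z - (L (x - z) + L (y - x)) by ring]
        refine h1.trans ?_
        gcongr
        have := norm_sub_le_norm_sub_add_norm_sub y x z
        rw [← dist_eq_norm x z] at this
        linarith
    exact ⟨l, fun y => (hl y).trans (by gcongr; exact le_max_right _ _)⟩

end Regularity

/-- **Theorem (optimal C^{1,1} regularity for the double obstacle problem on the flat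
torus).** -/
theorem dop_optimal_regularity {d : ℕ}
    (φm φp : Rd d → ℝ) (τ : ℝ) (hτ : 0 < τ)
    (hmreg : ContDiff ℝ 2 φm) (hpreg : ContDiff ℝ 2 φp)
    (hmper : PeriodicRd φm) (hpper : PeriodicRd φp)
    (hmnc : ∃ x y : Rd d, φm x ≠ φm y) (hpnc : ∃ x y : Rd d, φp x ≠ φp y)
    (hsep : ∀ x : Rd d, τ ≤ φp x - φm x)
    (hmaxmin : sInf (Set.range φp) ≤ sSup (Set.range φm)) :
    ∀ u : Rd d → ℝ, IsDOPSolution φm φp u →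
      ContDiff ℝ 1 u ∧ ∃ K : NNReal, LipschitzWith K (fderiv ℝ u) := by
  intro u hu
  obtain ⟨C, hC, h⟩ := hu.exists_taylor hmreg hpreg hmper hpper
  exact contDiff_one_and_lipschitzWith_of_taylor hC h
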